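/- Let $n \ge 1$, let $x, l, h \in \mathbb{R}^n$, let $L = l h^T + h l^T$, and let $P$ be the $2n \times 2n$ block matrix $\begin{pmatrix} A & B \\ B^T & A \end{pmatrix}$ with $a_{ij} = L_{ij}\cos(x_i - x_j)$ and $b_{ij} = L_{ij}\sin(x_i - x_j)$. Then $\mathrm{trace}(P^4) = 2\,\mathrm{trace}(L^4)$. -/

import Mathlib

open Matrix

/-- The block rotation matrix with diagonal blocks `cos x` and off-diagonal blocks `± sin x`. -/
noncomputable def blockRotation {ι : Type*} [DecidableEq ι] (x : ι → ℝ) :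
    Matrix (ι ⊕ ι) (ι ⊕ ι) ℝ :=
  fromBlocks (diagonal fun i => Real.cos (x i)) (diagonal fun i => Real.sin (x i))
    (-diagonal fun i => Real.sin (x i)) (diagonal fun i => Real.cos (x i))

theorem transpose_blockRotation_mul_self {ι : Type*} [Fintype ι] [DecidableEq ι] (x : ι → ℝ) :
    (blockRotation x)ᵀ * blockRotation x = 1 := by
  rw [blockRotation, fromBlocks_transpose, fromBlocks_multiply, ← fromBlocks_one]
  congr 1 <;> ext i j <;> obtain rfl | hij := eq_or_ne i j <;>
    simp_all [mul_comm (Real.sin _), ← sq (Real.sin _), ← sq (Real.cos _)]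

/-- Conjugating `L ⊕ L` by a block rotation gives the trigonometric block matrix of a
symmetric matrix `L`. -/
theorem blockRotation_conj {ι : Type*} [Fintype ι] [DecidableEq ι] (x : ι → ℝ)
    (L : Matrix ι ι ℝ) (hL : L.IsSymm) :
    fromBlocks (of fun i j => L i j * Real.cos (x i - x j))
        (of fun i j => L i j * Real.sin (x i - x j))
        (of fun i j => L i j * Real.sin (x i - x j))ᵀ
        (of fun i j => L i j * Real.cos (x i - x j)) =
      blockRotation x * fromBlocks L 0 0 L * (blockRotation x)ᵀ := by
  simp only [blockRotation, fromBlocks_transpose, fromBlocks_multiply, transpose_neg,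
    diagonal_transpose]
  congr 1 <;> ext i j <;>
    simp [Real.cos_sub, Real.sin_sub, hL.apply i j] <;> ring

theorem trace_conj_pow {m R : Type*} [Fintype m] [DecidableEq m] [CommRing R]
    (U V M : Matrix m m R) (hVU : V * U = 1) (k : ℕ) :
    ((U * M * V) ^ k).trace = (M ^ k).trace := by
  have hUV : U * V = 1 := mul_eq_one_comm.mp hVU
  have key : (U * M * V) ^ k = U * M ^ k * V := by
    induction k with
    | zero => simp [hUV]
    | succ k ih =>
      rw [pow_succ, ih, pow_succ]
      calc U * M ^ k * V * (U * M * V) = U * M ^ k * (V * U) * M * V := by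
            simp only [Matrix.mul_assoc]
        _ = U * (M ^ k * M) * V := by rw [hVU]; simp only [Matrix.mul_assoc, Matrix.one_mul]
  rw [key, trace_mul_comm, ← Matrix.mul_assoc, hVU, Matrix.one_mul]

theorem trace_fourth_gen_trig
    (n : ℕ) (hn : 1 ≤ n) (x l h : Fin n → ℝ)
    (L : Matrix (Fin n) (Fin n) ℝ)
    (hL : L = Matrix.of fun i j => l i * h j + h i * l j)
    (A B : Matrix (Fin n) (Fin n) ℝ)
    (hA : A = Matrix.of fun i j => L i j * Real.cos (x i - x j))
    (hB : B = Matrix.of fun i j => L i j * Real.sin (x i - x j))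
    (P : Matrix (Fin n ⊕ Fin n) (Fin n ⊕ Fin n) ℝ)
    (hP : P = Matrix.fromBlocks A B Bᵀ A) :
    (P ^ 4).trace = 2 * (L ^ 4).trace := by
  have hsymm : L.IsSymm := by
    ext i j
    simp only [hL, transpose_apply, of_apply]
    ring
  rw [hP, hA, hB, blockRotation_conj x L hsymm,
    trace_conj_pow _ _ _ (transpose_blockRotation_mul_self x), fromBlocks_diagonal_pow]
  simp [Matrix.trace, Fintype.sum_sum_type, two_mul]
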